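/- Let n and m be natural numbers with 1 ≤ m ≤ n. Then ∑_{k=1}^{n−m+1} k · C(n − k, m − 1) = C(n + 1, m + 1), where C(a, b) denotes the binomial coefficient. -/

import Mathlib

/-- The hockey-stick identity, summed twice. -/
theorem sum_range_sub_mul_add_choose (r d : ℕ) :
    ∑ i ∈ Finset.range (d + 1), (d + 1 - i) * (i + r).choose r = (d + r + 2).choose (r + 2) := by
  induction d with
  | zero => simp
  | succ d ih =>
    have split : ∀ i ∈ Finset.range (d + 1), (d + 1 + 1 - i) * (i + r).choose r =
        (d + 1 - i) * (i + r).choose r + (i + r).choose r := by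
      intro i hi
      rw [Nat.sub_add_comm (Finset.mem_range.mp hi).le, add_one_mul]
    have hockey := Nat.sum_range_add_choose (d + 1) r
    rw [Finset.sum_range_succ] at hockey
    rw [Finset.sum_range_succ, Finset.sum_congr rfl split, Finset.sum_add_distrib, ih,
      Nat.add_sub_cancel_left, one_mul, add_assoc, hockey,
      show d + 1 + r + 2 = d + r + 2 + 1 by ring, show d + 1 + r + 1 = d + r + 2 by ring,
      Nat.choose_succ_succ' (d + r + 2), add_comm]

theorem stmt_4 (n m : ℕ) (hm : 1 ≤ m) (hmn : m ≤ n) :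
    ∑ k ∈ Finset.Icc 1 (n - m + 1), k * Nat.choose (n - k) (m - 1) =
      Nat.choose (n + 1) (m + 1) := by
  obtain ⟨r, rfl⟩ := Nat.exists_eq_add_of_le' hm
  obtain ⟨d, rfl⟩ := Nat.exists_eq_add_of_le' hmn
  rw [show d + (r + 1) + 1 = d + r + 2 by ring, ← sum_range_sub_mul_add_choose]
  refine Finset.sum_nbij' (fun k => d + 1 - k) (fun i => d + 1 - i) ?_ ?_ ?_ ?_ ?_
  · intro k hk
    simp only [Finset.mem_Icc, Finset.mem_range] at *
    omega
  · intro i hi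
    simp only [Finset.mem_Icc, Finset.mem_range] at *
    omega
  · intro k hk
    simp only [Finset.mem_Icc] at *
    omega
  · intro i hi
    simp only [Finset.mem_range] at *
    omega
  · intro k hk
    rw [Finset.mem_Icc] at hk
    rw [show d + 1 - (d + 1 - k) = k by omega, show d + 1 - k + r = d + (r + 1) - k by omega,
      Nat.add_sub_cancel]
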